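/- Let A be an ℕ-graded commutative ring, a ∈ A_d a homogeneous element of degree d > 0, and M a ℤ-graded A-module. Then the degree-0 part M[a⁻¹]_0 of the localization is isomorphic, as a module over ⨁_{n≥0} A_{dn}, to the quotient of ⨁_{n≥0} M_{dn} by the submodule generated by all elements of the form a·x − x for x ∈ ⨁_{n≥0} M_{dn} (i.e., the quotient by the ideal action of (a − 1)). -/

import Mathlib

section

variable {A : Type*} [CommRing A]

/-- The sum `⨁_{n ≥ 0} M_{dn}` of the graded pieces of `M` in degrees divisible by `d`,
as an additive subgroup of `M`. -/
def veroneseModPart {M : Type*} [AddCommGroup M] (ℳ : ℤ → AddSubgroup M) (d : ℤ) :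
    AddSubgroup M :=
  AddSubgroup.closure (⋃ n : ℕ, (ℳ ((n : ℤ) * d) : Set M))

/-- The subgroup of `⨁_{n ≥ 0} M_{dn}` generated by the elements `a • x - x`. -/
def veroneseModRel {M : Type*} [AddCommGroup M] [Module A M]
    (ℳ : ℤ → AddSubgroup M) (a : A) (d : ℤ) : AddSubgroup M :=
  AddSubgroup.closure {y | ∃ x ∈ veroneseModPart ℳ d, y = a • x - x}

/-- The degree-zero part of the localization `M[a⁻¹]` for `a` of degree `d`:
spanned by fractions `m / aⁿ` with `m` homogeneous of degree `n·d`. -/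
def modDegZeroD (M : Type*) [AddCommGroup M] [Module A M]
    (ℳ : ℤ → AddSubgroup M) (a : A) (d : ℤ) :
    Submodule ℤ (LocalizedModule (Submonoid.powers a) M) :=
  Submodule.span ℤ
    {y | ∃ (n : ℕ) (m : M), m ∈ ℳ ((n : ℤ) * d) ∧ (a ^ n : A) • y = LocalizedModule.mk m 1}

end


section helpers

variable {A : Type*} [CommRing A] {M : Type*} [AddCommGroup M] [Module A M]

lemma vp_smul_inj (a : A) (n : ℕ) {x y : LocalizedModule (Submonoid.powers a) M}
    (h : (a ^ n : A) • x = (a ^ n : A) • y) : x = y := by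
  have := IsLocalizedModule.smul_injective (LocalizedModule.mkLinearMap (Submonoid.powers a) M)
    (⟨a ^ n, n, rfl⟩ : Submonoid.powers a)
  exact this h

lemma vp_smul_mk (a : A) (n : ℕ) (m : M) :
    (a ^ n : A) • (LocalizedModule.mk m (⟨a ^ n, n, rfl⟩ : Submonoid.powers a)) =
      LocalizedModule.mk m 1 := by
  rw [LocalizedModule.smul'_mk]
  exact LocalizedModule.mk_cancel (⟨a ^ n, n, rfl⟩ : Submonoid.powers a) m

/-- The map `m ↦ m / a ^ (deg m / d)`, extended additively. -/
noncomputable def vpMap (ℳ : ℤ → AddSubgroup M) [DirectSum.Decomposition ℳ] (a : A) (d : ℤ) :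
    M →+ LocalizedModule (Submonoid.powers a) M :=
  (DirectSum.toAddMonoid fun i : ℤ =>
    (AddMonoidHom.mk' (fun m : M => LocalizedModule.mk m
      (⟨a ^ (i / d).toNat, _, rfl⟩ : Submonoid.powers a))
      (fun x y => (by
        apply vp_smul_inj a (i / d).toNat
        rw [smul_add, vp_smul_mk, vp_smul_mk, vp_smul_mk]
        simp [LocalizedModule.mk_add_mk]))).comp (ℳ i).subtype).comp
    (DirectSum.decomposeAddEquiv ℳ).toAddMonoidHom

lemma vpMap_hom (ℳ : ℤ → AddSubgroup M) [DirectSum.Decomposition ℳ] (a : A) (d : ℤ)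
    (hd : 0 < d) (n : ℕ) (m : M) (hm : m ∈ ℳ ((n : ℤ) * d)) :
    (a ^ n : A) • vpMap ℳ a d m = LocalizedModule.mk m 1 := by
  have h : ((n : ℤ) * d / d).toNat = n := by
    rw [Int.mul_ediv_cancel _ hd.ne']; simp
  have h2 : vpMap ℳ a d m = LocalizedModule.mk m
      (⟨a ^ ((n : ℤ) * d / d).toNat, _, rfl⟩ : Submonoid.powers a) := by
    simp [vpMap, DirectSum.decompose_of_mem ℳ hm]
  rw [h2]
  conv_lhs => rw [← h]
  have := vp_smul_mk a ((n : ℤ) * d / d).toNat m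
  simp only [h] at this ⊢
  exact this

lemma vp_induction (ℳ : ℤ → AddSubgroup M) (d : ℤ) {p : M → Prop}
    (hm : ∀ (n : ℕ) (m : M), m ∈ ℳ ((n : ℤ) * d) → p m) (h0 : p 0)
    (hadd : ∀ x y, p x → p y → p (x + y)) (hneg : ∀ x, p x → p (-x))
    (x : M) (hx : x ∈ veroneseModPart ℳ d) : p x := by
  unfold veroneseModPart at hx
  induction hx using AddSubgroup.closure_induction with
  | mem x hx => obtain ⟨n, hn⟩ := Set.mem_iUnion.1 hx; exact hm n x hn
  | zero => exact h0
  | add x y _ _ hx hy => exact hadd x y hx hy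
  | neg x _ hx => exact hneg x hx

lemma vp_mem (ℳ : ℤ → AddSubgroup M) (d : ℤ) (n : ℕ) (m : M) (hm : m ∈ ℳ ((n : ℤ) * d)) :
    m ∈ veroneseModPart ℳ d :=
  AddSubgroup.subset_closure (Set.mem_iUnion.2 ⟨n, hm⟩)

lemma vpMap_smul (𝒜 : ℤ → Submodule ℤ A) (ℳ : ℤ → AddSubgroup M) [DirectSum.Decomposition ℳ]
    (hℳ : ∀ (i j : ℤ), ∀ c ∈ 𝒜 i, ∀ m ∈ ℳ j, c • m ∈ ℳ (i + j))
    (a : A) (d : ℤ) (hd : 0 < d) (k : ℕ) (v : A) (hv : v ∈ 𝒜 ((k : ℤ) * d))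
    (x : M) (hx : x ∈ veroneseModPart ℳ d) :
    (a ^ k : A) • vpMap ℳ a d (v • x) = v • vpMap ℳ a d x := by
  refine vp_induction ℳ d (p := fun x => (a ^ k : A) • vpMap ℳ a d (v • x) = v • vpMap ℳ a d x)
    ?_ ?_ ?_ ?_ x hx
  · intro n m hm
    have h1 : v • m ∈ ℳ (((k + n : ℕ) : ℤ) * d) := by
      have := hℳ _ _ v hv m hm
      rwa [← add_mul, ← Nat.cast_add] at this
    apply vp_smul_inj a n
    rw [smul_comm (a ^ n) v, vpMap_hom ℳ a d hd n m hm, smul_smul, ← pow_add, add_comm n k,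
      vpMap_hom ℳ a d hd _ _ h1, LocalizedModule.smul'_mk]
  · simp
  · intro x y h1 h2
    simp only [smul_add, map_add, h1, h2]
  · intro x h1
    simp only [smul_neg, map_neg, h1]

lemma vp_pow_mem (𝒜 : ℤ → Submodule ℤ A) (ℳ : ℤ → AddSubgroup M)
    (hℳ : ∀ (i j : ℤ), ∀ c ∈ 𝒜 i, ∀ m ∈ ℳ j, c • m ∈ ℳ (i + j))
    (a : A) (d : ℤ) (ha : a ∈ 𝒜 d) (k n : ℕ) (m : M) (hm : m ∈ ℳ ((n : ℤ) * d)) :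
    a ^ k • m ∈ ℳ (((k + n : ℕ) : ℤ) * d) ∧ m - a ^ k • m ∈ veroneseModRel (A := A) ℳ a d := by
  induction k with
  | zero => simpa using hm
  | succ k ih =>
    obtain ⟨h1, h2⟩ := ih
    constructor
    · have := hℳ _ _ a ha _ h1
      rw [smul_smul, ← pow_succ'] at this
      convert this using 2
      push_cast; ring
    · have h3 : a • (a ^ k • m) - a ^ k • m ∈ veroneseModRel (A := A) ℳ a d :=
        AddSubgroup.subset_closure ⟨_, vp_mem ℳ d _ _ h1, rfl⟩
      have := sub_mem h2 h3
      rw [smul_smul, ← pow_succ'] at this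
      convert this using 1
      abel

lemma vp_homog (𝒜 : ℤ → Submodule ℤ A) (ℳ : ℤ → AddSubgroup M)
    (hℳ : ∀ (i j : ℤ), ∀ c ∈ 𝒜 i, ∀ m ∈ ℳ j, c • m ∈ ℳ (i + j))
    (a : A) (d : ℤ) (ha : a ∈ 𝒜 d) (x : M) (hx : x ∈ veroneseModPart ℳ d) :
    ∃ N₀ : ℕ, ∀ N : ℕ, N₀ ≤ N → ∃ y ∈ ℳ ((N : ℤ) * d),
      x - y ∈ veroneseModRel (A := A) ℳ a d := by
  refine vp_induction ℳ d (p := fun x => ∃ N₀ : ℕ, ∀ N : ℕ, N₀ ≤ N → ∃ y ∈ ℳ ((N : ℤ) * d),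
      x - y ∈ veroneseModRel (A := A) ℳ a d) ?_ ?_ ?_ ?_ x hx
  · intro n m hm
    refine ⟨n, fun N hN => ?_⟩
    have := vp_pow_mem 𝒜 ℳ hℳ a d ha (N - n) n m hm
    rw [Nat.sub_add_cancel hN] at this
    exact ⟨_, this.1, this.2⟩
  · exact ⟨0, fun N _ => ⟨0, zero_mem _, by simp⟩⟩
  · rintro x y ⟨n1, h1⟩ ⟨n2, h2⟩
    refine ⟨max n1 n2, fun N hN => ?_⟩
    obtain ⟨u, hu, hu'⟩ := h1 N (le_trans (le_max_left _ _) hN)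
    obtain ⟨w, hw, hw'⟩ := h2 N (le_trans (le_max_right _ _) hN)
    refine ⟨u + w, add_mem hu hw, ?_⟩
    rw [add_sub_add_comm]
    exact add_mem hu' hw'
  · rintro x ⟨n1, h1⟩
    refine ⟨n1, fun N hN => ?_⟩
    obtain ⟨u, hu, hu'⟩ := h1 N hN
    refine ⟨-u, neg_mem hu, ?_⟩
    rw [← neg_sub', ]
    exact neg_mem hu'

lemma vpMap_rel (𝒜 : ℤ → Submodule ℤ A) (ℳ : ℤ → AddSubgroup M) [DirectSum.Decomposition ℳ]
    (hℳ : ∀ (i j : ℤ), ∀ c ∈ 𝒜 i, ∀ m ∈ ℳ j, c • m ∈ ℳ (i + j))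
    (a : A) (d : ℤ) (hd : 0 < d) (ha : a ∈ 𝒜 d) :
    veroneseModRel (A := A) ℳ a d ≤ (vpMap ℳ a d).ker := by
  unfold veroneseModRel
  rw [AddSubgroup.closure_le]
  rintro _ ⟨x, hx, rfl⟩
  have h := vpMap_smul 𝒜 ℳ hℳ a d hd 1 a (by simpa using ha) x hx
  have h' : vpMap ℳ a d (a • x) = vpMap ℳ a d x := by
    apply vp_smul_inj a 1
    rw [h, pow_one]
  simp [AddMonoidHom.mem_ker, h']

lemma vpMap_ker (𝒜 : ℤ → Submodule ℤ A) (ℳ : ℤ → AddSubgroup M) [DirectSum.Decomposition ℳ]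
    (hℳ : ∀ (i j : ℤ), ∀ c ∈ 𝒜 i, ∀ m ∈ ℳ j, c • m ∈ ℳ (i + j))
    (a : A) (d : ℤ) (hd : 0 < d) (ha : a ∈ 𝒜 d) (x : M) (hx : x ∈ veroneseModPart ℳ d)
    (h0 : vpMap ℳ a d x = 0) : x ∈ veroneseModRel (A := A) ℳ a d := by
  obtain ⟨N, hN⟩ := vp_homog 𝒜 ℳ hℳ a d ha x hx
  obtain ⟨y, hy, hxy⟩ := hN N le_rfl
  have h1 := vpMap_rel 𝒜 ℳ hℳ a d hd ha hxy
  rw [AddMonoidHom.mem_ker, map_sub, h0, zero_sub, neg_eq_zero] at h1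
  have h2 := vpMap_hom ℳ a d hd N y hy
  rw [h1, smul_zero, eq_comm, ← LocalizedModule.zero_mk 1, LocalizedModule.mk_eq] at h2
  obtain ⟨⟨_, K, rfl⟩, hK⟩ := h2
  have hK' : a ^ K • y = 0 := by simpa [Submonoid.smul_def] using hK
  have h3 := (vp_pow_mem 𝒜 ℳ hℳ a d ha K N y hy).2
  rw [hK', sub_zero] at h3
  simpa using add_mem hxy h3

end helpers

/-- for an ℕ-graded commutative ring `A`, `a ∈ A_d` with `d > 0`, and a ℤ-graded
`A`-module `M`, the degree-zero part `M[a⁻¹]₀` is isomorphic, compatibly with the action of the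
Veronese part `⨁_{n≥0} A_{dn}`, to the quotient of `⨁_{n≥0} M_{dn}` by the subgroup generated
by the elements `a·x − x`; the isomorphism sends (the class of) `m ∈ M_{dn}` to `m / aⁿ`. -/
theorem stmt5 {A : Type*} [CommRing A] (𝒜 : ℤ → Submodule ℤ A) [GradedAlgebra 𝒜]
    (hA : ∀ n : ℤ, n < 0 → 𝒜 n = ⊥)
    {M : Type*} [AddCommGroup M] [Module A M]
    (ℳ : ℤ → AddSubgroup M) [DirectSum.Decomposition ℳ]
    (hℳ : ∀ (i j : ℤ), ∀ c ∈ 𝒜 i, ∀ m ∈ ℳ j, c • m ∈ ℳ (i + j))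
    (a : A) (d : ℤ) (hd : 0 < d) (ha : a ∈ 𝒜 d) :
    ∃ e : (veroneseModPart ℳ d ⧸
            ((veroneseModRel (A := A) ℳ a d).addSubgroupOf (veroneseModPart ℳ d))) ≃+
          (modDegZeroD M ℳ a d),
      (∀ (n : ℕ) (m : M) (hm : m ∈ ℳ ((n : ℤ) * d)) (h : m ∈ veroneseModPart ℳ d),
        (a ^ n : A) • ((e (QuotientAddGroup.mk ⟨m, h⟩) :
            modDegZeroD M ℳ a d) : LocalizedModule (Submonoid.powers a) M)
          = LocalizedModule.mk m 1) ∧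
      (∀ (k : ℕ) (v : A), v ∈ 𝒜 ((k : ℤ) * d) →
        ∀ (x : M) (hx : x ∈ veroneseModPart ℳ d) (hvx : v • x ∈ veroneseModPart ℳ d),
        (a ^ k : A) • ((e (QuotientAddGroup.mk ⟨v • x, hvx⟩) :
            modDegZeroD M ℳ a d) : LocalizedModule (Submonoid.powers a) M)
          = v • ((e (QuotientAddGroup.mk ⟨x, hx⟩) :
            modDegZeroD M ℳ a d) : LocalizedModule (Submonoid.powers a) M)) := by
  have hmem : ∀ x : veroneseModPart ℳ d, vpMap ℳ a d x ∈ (modDegZeroD M ℳ a d).toAddSubgroup := by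
    rintro ⟨x, hx⟩
    refine vp_induction ℳ d
      (p := fun x => vpMap ℳ a d x ∈ (modDegZeroD M ℳ a d).toAddSubgroup) ?_ ?_ ?_ ?_ x hx
    · intro n m hm
      exact Submodule.subset_span ⟨n, m, hm, vpMap_hom ℳ a d hd n m hm⟩
    · simp
    · intro x y h1 h2
      rw [map_add]; exact add_mem h1 h2
    · intro x h1
      rw [map_neg]; exact neg_mem h1
  let ψ : veroneseModPart ℳ d →+ modDegZeroD M ℳ a d :=
    AddMonoidHom.mk' (fun x => ⟨vpMap ℳ a d x, hmem x⟩) (fun x y => by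
      apply Subtype.ext; simp)
  have hψ : ∀ x, (ψ x : LocalizedModule (Submonoid.powers a) M) = vpMap ℳ a d x := fun _ => rfl
  have hker : (veroneseModRel (A := A) ℳ a d).addSubgroupOf (veroneseModPart ℳ d) = ψ.ker := by
    ext x
    rw [AddSubgroup.mem_addSubgroupOf, AddMonoidHom.mem_ker]
    constructor
    · intro h
      exact Subtype.ext (vpMap_rel 𝒜 ℳ hℳ a d hd ha h)
    · intro h
      exact vpMap_ker 𝒜 ℳ hℳ a d hd ha x x.2 (by rw [← hψ, h]; rfl)
  have hsurj : Function.Surjective ψ := by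
    rintro ⟨y, hy⟩
    suffices h : ∃ x : veroneseModPart ℳ d, vpMap ℳ a d x = y by
      obtain ⟨x, hx⟩ := h
      exact ⟨x, Subtype.ext hx⟩
    unfold modDegZeroD at hy
    induction hy using Submodule.span_induction with
    | mem y hy =>
      obtain ⟨n, m, hm, h⟩ := hy
      refine ⟨⟨m, vp_mem ℳ d n m hm⟩, vp_smul_inj a n ?_⟩
      rw [h, vpMap_hom ℳ a d hd n m hm]
    | zero => exact ⟨0, by simp⟩
    | add y z _ _ hy hz =>
      obtain ⟨u, rfl⟩ := hy
      obtain ⟨w, rfl⟩ := hz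
      exact ⟨u + w, by simp⟩
    | smul c y _ hy =>
      obtain ⟨u, rfl⟩ := hy
      exact ⟨c • u, by simp⟩
  refine ⟨(QuotientAddGroup.quotientAddEquivOfEq hker).trans
    (QuotientAddGroup.quotientKerEquivOfSurjective ψ hsurj), ?_, ?_⟩
  · intro n m hm h
    exact vpMap_hom ℳ a d hd n m hm
  · intro k v hv x hx hvx
    exact vpMap_smul 𝒜 ℳ hℳ a d hd k v hv x hx
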